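/- arXiv:1712.09023 — 2 statements merged into one kernel-verified Lean document; each statement's English description precedes it below -/
import Mathlib

section
/- Let K be a θ-type kernel on ℝⁿ with size constant C₀ and b ∈ C_c¹(ℝⁿ). There is a constant C=C(n,C₀,C₁) such that for every η>0, every h ∈ ℝⁿ with |h| < η/4, every locally integrable f and every x: |∫_{ℝⁿ} (b(x+h)−b(y)) K(x+h,y) (ψ(|x−y|/η) − ψ(|x+h−y|/η)) f(y) dy| ≤ C η ‖∇b‖_∞ Mf(x). -/
open MeasureTheory Metric Filter Set
open scoped ENNReal Topology

noncomputable section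

abbrev Rn (n : ℕ) := EuclideanSpace ℝ (Fin n)

/-- θ is a modulus of continuity as in the paper: continuous, increasing,
subadditive on `[0,1]`, nonnegative, with `θ 0 = 0`. -/
def IsModulus (θ : ℝ → ℝ) : Prop :=
  ContinuousOn θ (Icc 0 1) ∧ MonotoneOn θ (Icc 0 1) ∧
    (∀ s t : ℝ, 0 ≤ s → 0 ≤ t → s + t ≤ 1 → θ (s + t) ≤ θ s + θ t) ∧
    θ 0 = 0 ∧ ∀ t ∈ Icc (0:ℝ) 1, 0 ≤ θ t

/-- The Dini condition `∫₀¹ θ(t)/t dt < ∞`. -/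
def DiniCondition (θ : ℝ → ℝ) : Prop :=
  IntegrableOn (fun t => θ t / t) (Ioc (0:ℝ) 1)

/-- `K` is a θ-type kernel with size constant `C₀`. -/
def IsThetaKernel (n : ℕ) (θ : ℝ → ℝ) (C₀ : ℝ) (K : Rn n → Rn n → ℝ) : Prop :=
  (∀ x y : Rn n, x ≠ y → |K x y| ≤ C₀ / ‖x - y‖ ^ n) ∧
    ∀ x x' y : Rn n, x ≠ y → 2 * ‖x - x'‖ ≤ ‖x - y‖ →
      |K x y - K x' y| + |K y x - K y x'| ≤ θ (‖x - x'‖ / ‖x - y‖) / ‖x - y‖ ^ n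

/-- The open cube centered at `c` with sidelength `r`. -/
def cube {n : ℕ} (c : Rn n) (r : ℝ) : Set (Rn n) := {x | ∀ i, |x i - c i| < r / 2}

/-- `ω` is a Muckenhoupt `A_p` weight (over cubes). -/
def IsAp (n : ℕ) (p : ℝ) (ω : Rn n → ℝ) : Prop :=
  (∀ᵐ x : Rn n, 0 < ω x) ∧ LocallyIntegrable ω volume ∧
    ∃ A : ℝ≥0∞, A ≠ ⊤ ∧ ∀ (c : Rn n) (r : ℝ), 0 < r →
      ((∫⁻ x in cube c r, ENNReal.ofReal (ω x)) / ENNReal.ofReal (r ^ n)) *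
        (((∫⁻ x in cube c r, ENNReal.ofReal (ω x ^ (1 - p / (p - 1)))) /
          ENNReal.ofReal (r ^ n)) ^ (p - 1)) ≤ A

/-- The measure `ω(x) dx`. -/
def wMeasure (n : ℕ) (ω : Rn n → ℝ) : Measure (Rn n) :=
  (volume : Measure (Rn n)).withDensity fun x => ENNReal.ofReal (ω x)

/-- Hardy–Littlewood maximal function, `ℝ≥0∞`-valued. -/
def maximal {n : ℕ} (f : Rn n → ℝ) (x : Rn n) : ℝ≥0∞ :=
  ⨆ (r : ℝ) (_ : 0 < r),
    (volume (ball x r))⁻¹ * ∫⁻ y in ball x r, ENNReal.ofReal |f y|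

/-- Mean oscillation of `b` over the ball `B(c,r)`. -/
def oscBall {n : ℕ} (b : Rn n → ℝ) (c : Rn n) (r : ℝ) : ℝ :=
  ⨍ x in ball c r, |b x - ⨍ y in ball c r, b y|

/-- `b ∈ BMO(ℝⁿ)`. -/
def IsBMO {n : ℕ} (b : Rn n → ℝ) : Prop :=
  LocallyIntegrable b volume ∧ ∃ C : ℝ, ∀ c r, 0 < r → oscBall b c r ≤ C

/-- The BMO norm of `b`. -/
def bmoNorm {n : ℕ} (b : Rn n → ℝ) : ℝ :=
  ⨆ c : Rn n, ⨆ r : {r : ℝ // 0 < r}, oscBall b c r.1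

/-- `b ∈ VMO(ℝⁿ)`: `b ∈ BMO` and its oscillation over balls of a fixed size tends to `0`
both as the size tends to `0` and as it tends to `∞`. -/
def IsVMO {n : ℕ} (b : Rn n → ℝ) : Prop :=
  IsBMO b ∧
    Tendsto (fun r : ℝ => ⨆ c : Rn n, oscBall b c r) (𝓝[>] 0) (𝓝 0) ∧
    Tendsto (fun r : ℝ => ⨆ c : Rn n, oscBall b c r) atTop (𝓝 0)

/-- `T` is an operator, bounded on `L²`, associated with the kernel `K`:
for smooth compactly supported `f` and a.e. `x` outside the support of `f`,
`T f x = ∫ K x y * f y dy`. -/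
def IsCZO (n : ℕ) (K : Rn n → Rn n → ℝ)
    (T : Lp ℝ 2 (volume : Measure (Rn n)) →L[ℝ] Lp ℝ 2 (volume : Measure (Rn n))) : Prop :=
  ∀ (f : Rn n → ℝ) (hf : MemLp f 2 (volume : Measure (Rn n))),
    ContDiff ℝ (⊤ : ℕ∞) f → HasCompactSupport f →
      ∀ᵐ x : Rn n, x ∉ tsupport f → (T (hf.toLp f) : Rn n → ℝ) x = ∫ y, K x y * f y

/-- Properties of the smooth truncation function `ψ`. -/
def PsiCond (ψ : ℝ → ℝ) (C₁ : ℝ) : Prop :=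
  (∀ t, 0 ≤ ψ t ∧ ψ t ≤ 1) ∧ (∀ t ≤ (1:ℝ)/2, ψ t = 0) ∧ (∀ t, 1 ≤ t → ψ t = 1) ∧
    ∀ t ∈ Ioo ((1:ℝ)/2) 1, |deriv ψ t| ≤ C₁

/-- The maximal commutator `[b,T*] f (x)`. -/
def maxComm {n : ℕ} (K : Rn n → Rn n → ℝ) (b f : Rn n → ℝ) (x : Rn n) : ℝ≥0∞ :=
  ⨆ (ε : ℝ) (_ : 0 < ε),
    ENNReal.ofReal |∫ y in {y : Rn n | ε ≤ dist x y}, (b x - b y) * K x y * f y|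

/-- The maximal truncated singular integral `T* f (x)`. -/
def truncT {n : ℕ} (K : Rn n → Rn n → ℝ) (f : Rn n → ℝ) (x : Rn n) : ℝ≥0∞ :=
  ⨆ (ε : ℝ) (_ : 0 < ε),
    ENNReal.ofReal |∫ y in {y : Rn n | ε ≤ dist x y}, K x y * f y|

/-- Weighted `L^p` "norm" of an `ℝ≥0∞`-valued function. -/
def wLpNorm {n : ℕ} (p : ℝ) (μ : Measure (Rn n)) (g : Rn n → ℝ≥0∞) : ℝ≥0∞ :=
  (∫⁻ x, g x ^ p ∂μ) ^ (1 / p)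

/-- `‖∇b‖_∞`. -/
def gradSup {n : ℕ} (b : Rn n → ℝ) : ℝ := ⨆ x : Rn n, ‖fderiv ℝ b x‖

/-- The maximal operator `M_b`. -/
def Mb {n : ℕ} (b f : Rn n → ℝ) (x : Rn n) : ℝ≥0∞ :=
  ⨆ (r : ℝ) (_ : 0 < r),
    (ENNReal.ofReal (r ^ n))⁻¹ * ∫⁻ y in ball x r, ENNReal.ofReal (|b x - b y| * |f y|)

theorem aux_lip {n : ℕ} (b : Rn n → ℝ) (hb : ContDiff ℝ 1 b) (hc : HasCompactSupport b)
    (u v : Rn n) : |b u - b v| ≤ gradSup b * ‖u - v‖ := by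
  have hbd : BddAbove (Set.range fun z : Rn n => ‖fderiv ℝ b z‖) := by
    obtain ⟨M, hM⟩ := (hc.fderiv (𝕜 := ℝ)).exists_bound_of_continuous
      (hb.continuous_fderiv (by norm_num))
    refine ⟨M, ?_⟩
    rintro _ ⟨z, rfl⟩
    exact hM z
  have h := Convex.norm_image_sub_le_of_norm_fderiv_le (𝕜 := ℝ) (f := b) (s := Set.univ)
    (C := gradSup b) (x := v) (y := u)
    (fun z _ => (hb.differentiable (by norm_num)) z)
    (fun z _ => le_ciSup hbd z) convex_univ (Set.mem_univ _) (Set.mem_univ _)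
  simpa [Real.norm_eq_abs] using h

theorem aux_grad_nonneg {n : ℕ} (b : Rn n → ℝ) : 0 ≤ gradSup b :=
  Real.iSup_nonneg fun _ => norm_nonneg _

theorem aux_pt {n : ℕ} {C₀ C₁ : ℝ} {θ ψ : ℝ → ℝ} (hψ : PsiCond ψ C₁) {K : Rn n → Rn n → ℝ}
    (hK : IsThetaKernel n θ C₀ K) {b : Rn n → ℝ} (hb : ContDiff ℝ 1 b) (hc : HasCompactSupport b)
    {η : ℝ} (hη : 0 < η) {h : Rn n} (hh : ‖h‖ < η / 4) (x y : Rn n) :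
    |(b (x + h) - b y) * K (x + h) y * (ψ (‖x - y‖ / η) - ψ (‖x + h - y‖ / η))| ≤
      (ball x (2 * η)).indicator
        (fun _ => (gradSup b * (2 * η)) * ((|C₀| + 1) / (η / 4) ^ n)) y := by
  obtain ⟨h01, h0, h1, -⟩ := hψ
  have e1 : ‖x + h - y‖ ≤ ‖x - y‖ + ‖h‖ := by
    have := norm_add_le (x - y) h
    rwa [show x - y + h = x + h - y by abel] at this
  have e2 : ‖x - y‖ ≤ ‖x + h - y‖ + ‖h‖ := by
    have := norm_sub_le (x + h - y) h
    rwa [show x + h - y - h = x - y by abel] at this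
  have hG := aux_grad_nonneg b
  have hpos : 0 ≤ (gradSup b * (2 * η)) * ((|C₀| + 1) / (η / 4) ^ n) := by positivity
  have hR : 0 ≤ (ball x (2 * η)).indicator
        (fun _ => (gradSup b * (2 * η)) * ((|C₀| + 1) / (η / 4) ^ n)) y :=
    Set.indicator_nonneg (fun _ _ => hpos) y
  by_cases c1 : 5 * η / 4 ≤ ‖x - y‖
  · rw [h1 (‖x - y‖ / η) (by rw [le_div_iff₀ hη]; linarith),
      h1 (‖x + h - y‖ / η) (by rw [le_div_iff₀ hη]; linarith)]
    simpa using hR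
  by_cases c2 : ‖x + h - y‖ ≤ η / 4
  · rw [h0 (‖x - y‖ / η) (by rw [div_le_iff₀ hη]; linarith),
      h0 (‖x + h - y‖ / η) (by rw [div_le_iff₀ hη]; linarith)]
    simpa using hR
  push Not at c1 c2
  rw [Set.indicator_of_mem (by rw [mem_ball, dist_comm, dist_eq_norm]; linarith)]
  have hne : x + h ≠ y := by
    intro e
    rw [e, sub_self, norm_zero] at c2
    linarith
  have hψ' : |ψ (‖x - y‖ / η) - ψ (‖x + h - y‖ / η)| ≤ 1 := by
    have p := h01 (‖x - y‖ / η)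
    have q := h01 (‖x + h - y‖ / η)
    rw [abs_le]; constructor <;> linarith
  have hK' : |K (x + h) y| ≤ (|C₀| + 1) / (η / 4) ^ n := by
    refine (hK.1 _ _ hne).trans ?_
    gcongr
    linarith [le_abs_self C₀]
  have hb' : |b (x + h) - b y| ≤ gradSup b * (2 * η) := by
    refine (aux_lip b hb hc _ _).trans ?_
    gcongr
    linarith
  rw [abs_mul, abs_mul]
  calc _ ≤ (gradSup b * (2 * η)) * ((|C₀| + 1) / (η / 4) ^ n) * 1 := by gcongr
    _ = _ := mul_one _

/-- If `K` is a θ-type kernel with size constant `C₀` and `b ∈ C_c¹(ℝⁿ)`,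
then there is `C = C(n, C₀, C₁)` such that for every `η > 0`, every `h` with `|h| < η/4`,
every locally integrable `f` and every `x`:
`|∫ (b(x+h)−b(y)) K(x+h,y) (ψ(|x−y|/η) − ψ(|x+h−y|/η)) f(y) dy| ≤ C η ‖∇b‖_∞ Mf(x)`. -/
theorem statement9 (n : ℕ) (C₀ C₁ : ℝ) :
    ∃ C : ℝ, 0 < C ∧
      ∀ θ : ℝ → ℝ, IsModulus θ →
      ∀ ψ : ℝ → ℝ, PsiCond ψ C₁ →
      ∀ K : Rn n → Rn n → ℝ, IsThetaKernel n θ C₀ K →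
      ∀ b : Rn n → ℝ, ContDiff ℝ 1 b → HasCompactSupport b →
      ∀ η : ℝ, 0 < η → ∀ h : Rn n, ‖h‖ < η / 4 →
      ∀ f : Rn n → ℝ, LocallyIntegrable f volume →
      ∀ x : Rn n,
        ENNReal.ofReal
            |∫ y, (b (x + h) - b y) * K (x + h) y *
              (ψ (‖x - y‖ / η) - ψ (‖x + h - y‖ / η)) * f y| ≤
          ENNReal.ofReal (C * η * gradSup b) * maximal f x := by
  have hv0 : volume (ball (0 : Rn n) 1) ≠ 0 := (measure_ball_pos _ _ one_pos).ne'
  have hvt : volume (ball (0 : Rn n) 1) ≠ ⊤ := measure_ball_lt_top.ne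
  set v : ℝ := (volume (ball (0 : Rn n) 1)).toReal with hv
  have hvpos : 0 < v := ENNReal.toReal_pos hv0 hvt
  refine ⟨2 * (|C₀| + 1) * 8 ^ n * v, by positivity, ?_⟩
  intro θ _ ψ hψ K hK b hb hc η hη h hh f _ x
  have hG := aux_grad_nonneg b
  set A : ℝ := (gradSup b * (2 * η)) * ((|C₀| + 1) / (η / 4) ^ n) with hA
  have hA0 : 0 ≤ A := by positivity
  have hvol : volume (ball x (2 * η)) = ENNReal.ofReal ((2 * η) ^ n * v) := by
    rw [Measure.addHaar_ball_of_pos volume x (by positivity : 0 < 2 * η), finrank_euclideanSpace,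
      Fintype.card_fin, ENNReal.ofReal_mul (by positivity), hv, ENNReal.ofReal_toReal hvt]
  have hCA : ENNReal.ofReal (2 * (|C₀| + 1) * 8 ^ n * v * η * gradSup b) *
      (volume (ball x (2 * η)))⁻¹ = ENNReal.ofReal A := by
    rw [hvol, ← ENNReal.ofReal_inv_of_pos (by positivity), ← ENNReal.ofReal_mul (by positivity)]
    congr 1
    rw [hA, show (8 : ℝ) = 2 * 4 by norm_num, mul_pow, mul_pow, div_pow]
    field_simp
  calc ENNReal.ofReal
            |∫ y, (b (x + h) - b y) * K (x + h) y *
              (ψ (‖x - y‖ / η) - ψ (‖x + h - y‖ / η)) * f y|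
      ≤ ∫⁻ y, ‖(b (x + h) - b y) * K (x + h) y *
              (ψ (‖x - y‖ / η) - ψ (‖x + h - y‖ / η)) * f y‖ₑ := by
        rw [← Real.enorm_eq_ofReal_abs]
        exact enorm_integral_le_lintegral_enorm _
    _ ≤ ∫⁻ y, (ball x (2 * η)).indicator
          (fun y => ENNReal.ofReal A * ENNReal.ofReal |f y|) y := by
        refine lintegral_mono fun y => ?_
        have hp := aux_pt hψ hK hb hc hη hh x y
        rw [enorm_mul, Real.enorm_eq_ofReal_abs, Real.enorm_eq_ofReal_abs]
        by_cases hy : y ∈ ball x (2 * η)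
        · rw [Set.indicator_of_mem hy] at hp ⊢
          gcongr
        · rw [Set.indicator_of_notMem hy] at hp ⊢
          rw [ENNReal.ofReal_of_nonpos hp, zero_mul]
    _ = ENNReal.ofReal A * ∫⁻ y in ball x (2 * η), ENNReal.ofReal |f y| := by
        rw [lintegral_indicator measurableSet_ball, lintegral_const_mul' _ _ ENNReal.ofReal_ne_top]
    _ = ENNReal.ofReal (2 * (|C₀| + 1) * 8 ^ n * v * η * gradSup b) *
        ((volume (ball x (2 * η)))⁻¹ * ∫⁻ y in ball x (2 * η), ENNReal.ofReal |f y|) := by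
        rw [← hCA, mul_assoc]
    _ ≤ _ := by
        gcongr
        exact le_iSup₂_of_le (f := fun (r : ℝ) (_ : 0 < r) =>
          (volume (ball x r))⁻¹ * ∫⁻ y in ball x r, ENNReal.ofReal |f y|)
          (2 * η) (by positivity) le_rfl
end
end

section
/- Let 1<p<∞ and let ω be a Muckenhoupt A_p weight on ℝⁿ. Then there exist q ∈ (0,p) and a constant C>0 such that for every R ≥ 1: ∫_{|x|>R} ω(x) |x|^{−np} dx ≤ C R^{−n(p−q)}; in particular ∫_{|x|>R} ω(x)|x|^{−np} dx is finite and tends to 0 as R→∞. -/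
open MeasureTheory Metric Filter Set
open scoped ENNReal Topology

noncomputable section

lemma aux_cube_meas {n : ℕ} (c : Rn n) (r : ℝ) : MeasurableSet (cube c r) := by
  have : cube c r = ⋂ i, {x : Rn n | |x i - c i| < r / 2} := by
    ext x; simp [cube]
  rw [this]
  refine MeasurableSet.iInter fun i => ?_
  exact (isOpen_lt (by fun_prop) (by fun_prop)).measurableSet

lemma aux_cube_vol {n : ℕ} (c : Rn n) (r : ℝ) (hr : 0 < r) :
    volume (cube c r) = ENNReal.ofReal (r ^ n) := by
  have h : cube c r = (MeasurableEquiv.toLp 2 (Fin n → ℝ)).symm ⁻¹'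
      (Set.pi univ fun i => Ioo (c i - r / 2) (c i + r / 2)) := by
    ext x
    simp only [cube, Set.mem_ofPred_eq, mem_preimage, Set.mem_pi, mem_univ, true_imp_iff, mem_Ioo, abs_lt]
    refine forall_congr' fun i => ?_
    have : (MeasurableEquiv.toLp 2 (Fin n → ℝ)).symm x i = x i := rfl
    rw [this]
    constructor
    · rintro ⟨a, b⟩; constructor <;> linarith
    · rintro ⟨a, b⟩; constructor <;> linarith
  rw [h, (EuclideanSpace.volume_preserving_symm_measurableEquiv_toLp (Fin n)).measure_preimage
    (MeasurableSet.univ_pi fun i => measurableSet_Ioo).nullMeasurableSet, Real.volume_pi_Ioo]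
  have : ∀ i, c i + r / 2 - (c i - r / 2) = r := fun i => by ring
  simp [this, ENNReal.ofReal_pow hr.le]

lemma aux_holder {n : ℕ} (p : ℝ) (hp : 1 < p) (ω : Rn n → ℝ)
    (hpos : ∀ᵐ x : Rn n, 0 < ω x) (hm : AEMeasurable ω volume) (Q : Set (Rn n)) :
    volume Q ^ p ≤ (∫⁻ x in Q, ENNReal.ofReal (ω x)) *
      (∫⁻ x in Q, ENNReal.ofReal (ω x ^ (1 - p / (p - 1)))) ^ (p - 1) := by
  have hp1 : 0 < p - 1 := by linarith
  have hp0 : 0 < p := by linarith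
  have hpq : p.HolderConjugate (p / (p - 1)) := Real.HolderConjugate.conjExponent hp
  have key := ENNReal.lintegral_mul_le_Lp_mul_Lq (volume.restrict Q) hpq
    (f := fun x => ENNReal.ofReal (ω x ^ (1 / p)))
    (g := fun x => ENNReal.ofReal (ω x ^ (-(1 / p))))
    (by have := hm.restrict (s := Q); fun_prop) (by have := hm.restrict (s := Q); fun_prop)
  have h1 : ∫⁻ x in Q, ((fun x => ENNReal.ofReal (ω x ^ (1 / p))) *
      (fun x => ENNReal.ofReal (ω x ^ (-(1 / p))))) x = volume Q := by
    rw [← setLIntegral_one]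
    refine lintegral_congr_ae (ae_restrict_of_ae ?_)
    filter_upwards [hpos] with x hx
    simp only [Pi.mul_apply]
    rw [← ENNReal.ofReal_mul (by positivity), ← Real.rpow_add hx]
    simp
  have h2 : ∫⁻ x in Q, ENNReal.ofReal (ω x ^ (1 / p)) ^ p = ∫⁻ x in Q, ENNReal.ofReal (ω x) := by
    refine lintegral_congr_ae (ae_restrict_of_ae ?_)
    filter_upwards [hpos] with x hx
    rw [ENNReal.ofReal_rpow_of_nonneg (by positivity) hp0.le, ← Real.rpow_mul hx.le]
    rw [one_div_mul_cancel hp0.ne', Real.rpow_one]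
  have h3 : ∫⁻ x in Q, ENNReal.ofReal (ω x ^ (-(1 / p))) ^ (p / (p - 1))
      = ∫⁻ x in Q, ENNReal.ofReal (ω x ^ (1 - p / (p - 1))) := by
    refine lintegral_congr_ae (ae_restrict_of_ae ?_)
    filter_upwards [hpos] with x hx
    rw [ENNReal.ofReal_rpow_of_nonneg (by positivity) (by positivity), ← Real.rpow_mul hx.le]
    congr 2
    field_simp
    ring
  rw [h1, h2, h3] at key
  calc volume Q ^ p ≤ _ := ENNReal.rpow_le_rpow key hp0.le
    _ = _ := by
      rw [ENNReal.mul_rpow_of_nonneg _ _ hp0.le, ← ENNReal.rpow_mul, ← ENNReal.rpow_mul,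
        one_div_mul_cancel hp0.ne', ENNReal.rpow_one]
      congr 2
      field_simp

lemma aux_Ap {a b V A : ℝ≥0∞} {p : ℝ} (hp : 1 < p) (hV : V ≠ 0) (hV' : V ≠ ⊤)
    (h : a / V * (b / V) ^ (p - 1) ≤ A) : a * b ^ (p - 1) ≤ A * V ^ p := by
  have hp1 : 0 < p - 1 := by linarith
  have e : V ^ p = V * V ^ (p - 1) := by
    nth_rw 2 [← ENNReal.rpow_one V]
    rw [← ENNReal.rpow_add _ _ hV hV']; congr 1; ring
  calc a * b ^ (p - 1) = (a / V * V) * (b / V * V) ^ (p - 1) := by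
        rw [ENNReal.div_mul_cancel hV hV', ENNReal.div_mul_cancel hV hV']
    _ = (a / V * (b / V) ^ (p - 1)) * V ^ p := by
        rw [ENNReal.mul_rpow_of_nonneg _ _ hp1.le, e]; ring
    _ ≤ _ := by gcongr

lemma aux_disj {n : ℕ} (i : Fin n) (r : ℝ) :
    Disjoint (cube (0 : Rn n) r) (cube (EuclideanSpace.single i r) r) := by
  rw [Set.disjoint_left]
  intro x h1 h2
  have h1 := h1 i
  have h2 := h2 i
  simp [abs_lt] at h1 h2
  linarith [h1.2, h2.1]

lemma aux_sub {n : ℕ} (i : Fin n) (r : ℝ) (hr : 0 < r) :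
    cube (0 : Rn n) r ∪ cube (EuclideanSpace.single i r) r ⊆ cube (0 : Rn n) (3 * r) := by
  rintro x (h | h) j
  · have := h j
    simp only [abs_lt] at this ⊢
    constructor <;> linarith [this.1, this.2]
  · have := h j
    simp only [abs_lt, PiLp.single_apply, PiLp.zero_apply] at this ⊢
    split_ifs at this <;> constructor <;> linarith [this.1, this.2]

lemma aux_growth {n : ℕ} (i : Fin n) (p : ℝ) (hp : 1 < p) (ω : Rn n → ℝ) (hω : IsAp n p ω) :
    ∃ B θ : ℝ, 0 < B ∧ 0 < θ ∧ θ < 1 ∧ ∀ k : ℕ,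
      ∫⁻ x in cube (0 : Rn n) (3 ^ k), ENNReal.ofReal (ω x) ≤
        ENNReal.ofReal (B * ((3 : ℝ) ^ (n * p) * θ) ^ k) := by
  obtain ⟨hpos, hloc, A, hA, hAp⟩ := hω
  have hm : AEMeasurable ω volume := hloc.aestronglyMeasurable.aemeasurable
  have hp1 : 0 < p - 1 := by linarith
  have hp0 : 0 < p := by linarith
  set W : Set (Rn n) → ℝ≥0∞ := fun Q => ∫⁻ x in Q, ENNReal.ofReal (ω x) with hW
  set S : Set (Rn n) → ℝ≥0∞ := fun Q => ∫⁻ x in Q, ENNReal.ofReal (ω x ^ (1 - p / (p - 1))) with hS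
  have hAp' : ∀ c r, 0 < r → W (cube c r) * S (cube c r) ^ (p - 1)
      ≤ A * ENNReal.ofReal (r ^ n) ^ p := fun c r hr =>
    aux_Ap hp (by simp; positivity) (by simp) (hAp c r hr)
  have hH : ∀ c r, 0 < r → ENNReal.ofReal (r ^ n) ^ p ≤
      W (cube c r) * S (cube c r) ^ (p - 1) := fun c r hr => by
    have := aux_holder p hp ω hpos hm (cube c r)
    rwa [aux_cube_vol c r hr] at this
  have hVpos : ∀ r : ℝ, 0 < r → 0 < ENNReal.ofReal (r ^ n) ^ p := fun r hr =>
    ENNReal.rpow_pos (by simp; positivity) (by simp)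
  have hVtop : ∀ r : ℝ, ENNReal.ofReal (r ^ n) ^ p ≠ ⊤ := fun r =>
    ENNReal.rpow_ne_top_of_nonneg hp0.le (by simp)
  have hWpos : ∀ c r, 0 < r → W (cube c r) ≠ 0 := fun c r hr h => by
    have := (hVpos r hr).trans_le (hH c r hr)
    simp [h] at this
  have hSpos : ∀ c r, 0 < r → S (cube c r) ≠ 0 := fun c r hr h => by
    have := (hVpos r hr).trans_le (hH c r hr)
    simp [h, ENNReal.zero_rpow_of_pos hp1] at this
  have hStop : ∀ c r, 0 < r → S (cube c r) ≠ ⊤ := fun c r hr h => by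
    have := hAp' c r hr
    rw [h, ENNReal.top_rpow_of_pos hp1, ENNReal.mul_top (hWpos c r hr), top_le_iff] at this
    exact ENNReal.mul_ne_top hA (hVtop r) this
  have hWtop : ∀ c r, 0 < r → W (cube c r) ≠ ⊤ := fun c r hr h => by
    have := hAp' c r hr
    rw [h, ENNReal.top_mul (ENNReal.rpow_pos (pos_iff_ne_zero.2 (hSpos c r hr))
      (hStop c r hr)).ne', top_le_iff] at this
    exact ENNReal.mul_ne_top hA (hVtop r) this
  -- doubling of the dual weight
  set K : ℝ≥0∞ := ENNReal.ofReal (3 ^ n) ^ p with hK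
  have hVmul : ∀ r : ℝ, 0 < r → ENNReal.ofReal ((3 * r) ^ n) ^ p =
      K * ENNReal.ofReal (r ^ n) ^ p := fun r hr => by
    rw [mul_pow, ENNReal.ofReal_mul (by positivity), ENNReal.mul_rpow_of_nonneg _ _ hp0.le]
  have hKtop : K ≠ ⊤ := ENNReal.rpow_ne_top_of_nonneg hp0.le (by simp)
  set D : ℝ≥0∞ := (A * K) ^ (1 / (p - 1)) with hD
  have hDtop : D ≠ ⊤ := ENNReal.rpow_ne_top_of_nonneg (by positivity) (ENNReal.mul_ne_top hA hKtop)
  have hdoub : ∀ r : ℝ, 0 < r → S (cube 0 (3 * r)) ≤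
      D * S (cube (EuclideanSpace.single i r) r) := fun r hr => by
    set Q' := cube (EuclideanSpace.single i r) r with hQ'
    set Q3 := cube (0 : Rn n) (3 * r) with hQ3
    have hsub : Q' ⊆ Q3 := subset_union_right.trans (aux_sub i r hr)
    have hWm : W Q' ≤ W Q3 := lintegral_mono_set hsub
    have h3r : 0 < 3 * r := by linarith
    have e1 : S Q3 ^ (p - 1) * ENNReal.ofReal (r ^ n) ^ p ≤
        (A * K * S Q' ^ (p - 1)) * ENNReal.ofReal (r ^ n) ^ p := by
      calc S Q3 ^ (p - 1) * ENNReal.ofReal (r ^ n) ^ p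
          ≤ S Q3 ^ (p - 1) * (W Q3 * S Q' ^ (p - 1)) := by
            gcongr
            exact (hH _ r hr).trans (by gcongr)
        _ = (W Q3 * S Q3 ^ (p - 1)) * S Q' ^ (p - 1) := by ring
        _ ≤ (A * (K * ENNReal.ofReal (r ^ n) ^ p)) * S Q' ^ (p - 1) := by
            rw [← hVmul r hr]
            exact mul_le_mul_left (hAp' _ _ h3r) _
        _ = _ := by ring
    have e2 : S Q3 ^ (p - 1) ≤ A * K * S Q' ^ (p - 1) :=
      (ENNReal.mul_le_mul_iff_left (hVpos r hr).ne' (hVtop r)).1 e1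
    have e3 := ENNReal.rpow_le_rpow e2 (z := 1 / (p - 1)) (by positivity)
    rwa [ENNReal.mul_rpow_of_nonneg _ _ (by positivity), ← ENNReal.rpow_mul, ← ENNReal.rpow_mul,
      mul_one_div_cancel hp1.ne', ENNReal.rpow_one, ENNReal.rpow_one] at e3
  -- reverse doubling
  set d : ℝ := D.toReal + 2 with hd
  have hd2 : 2 ≤ d := by have := D.toReal_nonneg; linarith
  set ρ : ℝ := 1 - 1 / d with hρ
  have hρ0 : 0 < ρ := by
    have : 1 / d ≤ 1 / 2 := one_div_le_one_div_of_le (by norm_num) hd2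
    linarith
  have hρ1 : ρ < 1 := by
    have : 0 < 1 / d := by positivity
    linarith
  have hrev : ∀ r : ℝ, 0 < r → S (cube 0 r) ≤ ENNReal.ofReal ρ * S (cube 0 (3 * r)) := fun r hr => by
    have h3r : 0 < 3 * r := by linarith
    have e1 : S (cube 0 r) + S (cube (EuclideanSpace.single i r) r) ≤ S (cube 0 (3 * r)) := by
      rw [hS]
      dsimp only
      rw [← lintegral_union (aux_cube_meas _ _) (aux_disj i r)]
      exact lintegral_mono_set (aux_sub i r hr)
    have e2 := hdoub r hr
    have t0 := hStop 0 r hr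
    have t1 := hStop (EuclideanSpace.single i r) r hr
    have t3 := hStop 0 _ h3r
    rw [← ENNReal.ofReal_toReal t3, ← ENNReal.ofReal_mul hρ0.le, ← ENNReal.ofReal_toReal t0]
    apply ENNReal.ofReal_le_ofReal
    have f1 := ENNReal.toReal_mono t3 e1
    rw [ENNReal.toReal_add t0 t1] at f1
    have f2 := ENNReal.toReal_mono (ENNReal.mul_ne_top hDtop t1) e2
    rw [ENNReal.toReal_mul] at f2
    have f3 : (S (cube 0 (3 * r))).toReal / d ≤ (S (cube (EuclideanSpace.single i r) r)).toReal := by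
      rw [div_le_iff₀ (by linarith)]
      have := (S (cube (EuclideanSpace.single i r) r)).toReal_nonneg
      nlinarith
    rw [hρ, sub_mul, one_mul, one_div_mul_eq_div]
    linarith
  have hiter : ∀ k : ℕ, S (cube 0 1) ≤ ENNReal.ofReal ρ ^ k * S (cube 0 (3 ^ k)) := fun k => by
    induction k with
    | zero => simp
    | succ k ih =>
      refine ih.trans ?_
      rw [pow_succ, mul_assoc, pow_succ' (3 : ℝ)]
      gcongr
      exact hrev _ (by positivity)
  set θ : ℝ := ρ ^ (p - 1) with hθ
  have hθ0 : 0 < θ := by positivity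
  have hθ1 : θ < 1 := Real.rpow_lt_one hρ0.le hρ1 hp1
  set s1 := S (cube 0 1) ^ (p - 1) with hs1
  have hs10 : s1 ≠ 0 := (ENNReal.rpow_pos (pos_iff_ne_zero.2 (hSpos 0 1 one_pos))
      (hStop 0 1 one_pos)).ne'
  have hs1t : s1 ≠ ⊤ := ENNReal.rpow_ne_top_of_nonneg hp1.le (hStop 0 1 one_pos)
  have hfin : ∀ k : ℕ, W (cube 0 (3 ^ k)) * s1 ≤ A * ENNReal.ofReal (((3 : ℝ) ^ (n * p) * θ) ^ k) := by
    intro k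
    have e1 : s1 ≤ ENNReal.ofReal (θ ^ k) * S (cube 0 (3 ^ k)) ^ (p - 1) := by
      calc s1 ≤ (ENNReal.ofReal ρ ^ k * S (cube 0 (3 ^ k))) ^ (p - 1) :=
            ENNReal.rpow_le_rpow (hiter k) hp1.le
        _ = _ := by
          rw [ENNReal.mul_rpow_of_nonneg _ _ hp1.le, ← ENNReal.ofReal_pow hρ0.le,
            ENNReal.ofReal_rpow_of_nonneg (by positivity) hp1.le, hθ,
            Real.rpow_pow_comm hρ0.le]
    have e2 : ENNReal.ofReal (((3 : ℝ) ^ k) ^ n) ^ p = ENNReal.ofReal (((3 : ℝ) ^ (n * p)) ^ k) := by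
      rw [ENNReal.ofReal_rpow_of_nonneg (by positivity) hp0.le]
      congr 1
      rw [← Real.rpow_natCast, ← Real.rpow_natCast, ← Real.rpow_natCast, ← Real.rpow_mul (by norm_num),
        ← Real.rpow_mul (by norm_num), ← Real.rpow_mul (by norm_num)]
      congr 1; ring
    calc W (cube 0 (3 ^ k)) * s1 ≤ W (cube 0 (3 ^ k)) *
          (ENNReal.ofReal (θ ^ k) * S (cube 0 (3 ^ k)) ^ (p - 1)) := by gcongr
      _ = (W (cube 0 (3 ^ k)) * S (cube 0 (3 ^ k)) ^ (p - 1)) * ENNReal.ofReal (θ ^ k) := by ring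
      _ ≤ (A * ENNReal.ofReal (((3 : ℝ) ^ k) ^ n) ^ p) * ENNReal.ofReal (θ ^ k) := by
        exact mul_le_mul_left (hAp' _ _ (by positivity)) _
      _ = _ := by
        rw [e2, mul_assoc, ← ENNReal.ofReal_mul (by positivity), mul_pow]
  have hAs : A / s1 ≠ ⊤ := ENNReal.div_ne_top hA hs10
  refine ⟨(A / s1).toReal + 1, θ, by positivity, hθ0, hθ1, fun k => ?_⟩
  calc W (cube 0 (3 ^ k)) ≤ (A * ENNReal.ofReal (((3 : ℝ) ^ (n * p) * θ) ^ k)) / s1 :=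
        (ENNReal.le_div_iff_mul_le (Or.inl hs10) (Or.inl hs1t)).2 (hfin k)
    _ = A / s1 * ENNReal.ofReal (((3 : ℝ) ^ (n * p) * θ) ^ k) := by
        rw [div_eq_mul_inv, div_eq_mul_inv]; ring
    _ ≤ _ := by
        rw [ENNReal.ofReal_mul (by positivity)]
        gcongr
        rw [← ENNReal.ofReal_toReal hAs]
        apply ENNReal.ofReal_le_ofReal
        rw [ENNReal.toReal_ofReal ENNReal.toReal_nonneg]
        linarith

lemma aux_annulus {n : ℕ} (p : ℝ) (hp : 0 < p) (ω : Rn n → ℝ) (hpos : ∀ᵐ x : Rn n, 0 < ω x) (j : ℕ) :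
    ∫⁻ x in {x : Rn n | 3 ^ j < ‖x‖ ∧ ‖x‖ ≤ 3 ^ (j + 1)},
      ENNReal.ofReal (ω x * ‖x‖ ^ (-((n : ℝ) * p))) ≤
    ENNReal.ofReal ((((3 : ℝ) ^ (n * p)) ^ j)⁻¹) *
      ∫⁻ x in cube (0 : Rn n) (3 ^ (j + 2)), ENNReal.ofReal (ω x) := by
  have hms : MeasurableSet {x : Rn n | 3 ^ j < ‖x‖ ∧ ‖x‖ ≤ 3 ^ (j + 1)} :=
    (measurableSet_lt measurable_const measurable_norm).inter
      (measurableSet_le measurable_norm measurable_const)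
  have hsub : {x : Rn n | 3 ^ j < ‖x‖ ∧ ‖x‖ ≤ 3 ^ (j + 1)} ⊆ cube (0 : Rn n) (3 ^ (j + 2)) := by
    intro x hx i
    have h1 : |x i| ≤ ‖x‖ := by simpa using PiLp.norm_apply_le x i
    have h2 : ‖x‖ ≤ 3 ^ (j + 1) := hx.2
    have h3 : (0 : ℝ) < 3 ^ j := by positivity
    simp only [PiLp.zero_apply, sub_zero]
    rw [pow_succ] at h2
    rw [pow_add]
    linarith
  calc _ ≤ ∫⁻ x in {x : Rn n | 3 ^ j < ‖x‖ ∧ ‖x‖ ≤ 3 ^ (j + 1)},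
        ENNReal.ofReal ((((3 : ℝ) ^ (n * p)) ^ j)⁻¹) * ENNReal.ofReal (ω x) := by
        refine lintegral_mono_ae ?_
        filter_upwards [ae_restrict_of_ae hpos, ae_restrict_mem hms] with x hx hxm
        rw [← ENNReal.ofReal_mul (by positivity), mul_comm (ω x)]
        apply ENNReal.ofReal_le_ofReal
        gcongr
        rw [Real.rpow_pow_comm (by norm_num), ← Real.rpow_neg (by positivity)]
        exact Real.rpow_le_rpow_of_nonpos (by positivity) hxm.1.le
          (by have : 0 ≤ (n : ℝ) * p := by positivity
              linarith)
    _ = ENNReal.ofReal ((((3 : ℝ) ^ (n * p)) ^ j)⁻¹) *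
        ∫⁻ x in {x : Rn n | 3 ^ j < ‖x‖ ∧ ‖x‖ ≤ 3 ^ (j + 1)}, ENNReal.ofReal (ω x) :=
        lintegral_const_mul' _ _ ENNReal.ofReal_ne_top
    _ ≤ _ := by
        gcongr

lemma aux_decay {n : ℕ} (hn : 0 < n) (p : ℝ) (hp : 1 < p) (ω : Rn n → ℝ) (hω : IsAp n p ω) :
    ∃ C t : ℝ, 0 < C ∧ 0 < t ∧ t ≤ n * p / 2 ∧ ∀ R : ℝ, 1 ≤ R →
      (∫⁻ x in {x : Rn n | R < ‖x‖},
            ENNReal.ofReal (ω x * ‖x‖ ^ (-((n : ℝ) * p)))) ≤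
          ENNReal.ofReal (C * R ^ (-t)) := by
  have hn' : (0 : ℝ) < n := by exact_mod_cast hn
  obtain ⟨B, θ, hB, hθ0, hθ1, hW⟩ := aux_growth ⟨0, hn⟩ p hp ω hω
  have hpos := hω.1
  set L : ℝ := (3 : ℝ) ^ (n * p) with hL
  have hL0 : 0 < L := by positivity
  set M : ℝ := B * (L * θ) ^ 2 with hM
  have hM0 : 0 < M := by positivity
  have hann : ∀ j : ℕ, ∫⁻ x in {x : Rn n | 3 ^ j < ‖x‖ ∧ ‖x‖ ≤ 3 ^ (j + 1)},
      ENNReal.ofReal (ω x * ‖x‖ ^ (-((n : ℝ) * p))) ≤ ENNReal.ofReal (M * θ ^ j) := by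
    intro j
    refine (aux_annulus p (by linarith) ω hpos j).trans ?_
    refine (mul_le_mul_right (hW (j + 2)) _).trans ?_
    rw [← ENNReal.ofReal_mul (by positivity)]
    apply ENNReal.ofReal_le_ofReal
    apply le_of_eq
    rw [hM]
    field_simp
    ring
  have htail : ∀ k : ℕ, ∫⁻ x in {x : Rn n | 3 ^ k < ‖x‖},
      ENNReal.ofReal (ω x * ‖x‖ ^ (-((n : ℝ) * p))) ≤ ENNReal.ofReal (M * θ ^ k * (1 - θ)⁻¹) := by
    intro k
    have hsub : {x : Rn n | 3 ^ k < ‖x‖} ⊆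
        ⋃ j : ℕ, {x : Rn n | 3 ^ (k + j) < ‖x‖ ∧ ‖x‖ ≤ 3 ^ (k + j + 1)} := by
      intro x hx
      have hx : 3 ^ k < ‖x‖ := hx
      have hx0 : 0 < ‖x‖ := lt_trans (by positivity) hx
      obtain ⟨m, hm1, hm2⟩ := exists_mem_Ioc_zpow hx0 (by norm_num : (1 : ℝ) < 3)
      have hkm : (k : ℤ) < m + 1 := by
        have : (3 : ℝ) ^ (k : ℤ) < 3 ^ (m + 1) := by
          rw [zpow_natCast]; exact hx.trans_le hm2
        exact (zpow_lt_zpow_iff_right₀ (by norm_num)).1 this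
      obtain ⟨j, hj⟩ := Int.eq_ofNat_of_zero_le (by omega : 0 ≤ m - k)
      have hmj : m = ((k + j : ℕ) : ℤ) := by push_cast; omega
      refine mem_iUnion.2 ⟨j, ?_, ?_⟩
      · rw [hmj, zpow_natCast] at hm1; exact hm1
      · rw [hmj] at hm2; exact_mod_cast hm2
    refine (lintegral_mono_set hsub).trans ((lintegral_iUnion_le _ _).trans ?_)
    refine (ENNReal.tsum_le_tsum fun j => hann (k + j)).trans ?_
    have hs : HasSum (fun j : ℕ => M * θ ^ (k + j)) (M * θ ^ k * (1 - θ)⁻¹) := by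
      have := (hasSum_geometric_of_lt_one hθ0.le hθ1).mul_left (M * θ ^ k)
      simpa [pow_add, mul_assoc] using this
    rw [← hs.tsum_eq, ENNReal.ofReal_tsum_of_nonneg (fun j => by positivity) hs.summable]
  have hlog3 : 0 < Real.log 3 := Real.log_pos (by norm_num)
  have hlogθ : Real.log θ < 0 := Real.log_neg hθ0 hθ1
  set s : ℝ := -Real.log θ / Real.log 3 with hs
  have hs0 : 0 < s := div_pos (by linarith) hlog3
  have h3s : (3 : ℝ) ^ (-s) = θ := by
    rw [Real.rpow_def_of_pos (by norm_num), hs]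
    rw [show Real.log 3 * -(-Real.log θ / Real.log 3) = Real.log θ by field_simp]
    exact Real.exp_log hθ0
  have h1θ : 0 < 1 - θ := by linarith
  refine ⟨M * (1 - θ)⁻¹ * θ⁻¹, min s (n * p / 2), by positivity,
    lt_min hs0 (by positivity), min_le_right _ _, fun R hR => ?_⟩
  obtain ⟨k, hk1, hk2⟩ := exists_nat_pow_near hR (by norm_num : (1 : ℝ) < 3)
  have hsub : {x : Rn n | R < ‖x‖} ⊆ {x : Rn n | 3 ^ k < ‖x‖} := fun x hx => hk1.trans_lt hx
  refine (lintegral_mono_set hsub).trans ((htail k).trans ?_)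
  apply ENNReal.ofReal_le_ofReal
  have hR0 : 0 < R := by linarith
  have h1 : θ ^ (k + 1) ≤ R ^ (-min s (n * p / 2)) := by
    calc θ ^ (k + 1) = ((3 : ℝ) ^ (k + 1)) ^ (-s) := by
          rw [← h3s, Real.rpow_pow_comm (by norm_num)]
      _ ≤ R ^ (-s) := Real.rpow_le_rpow_of_nonpos hR0 hk2.le (by linarith)
      _ ≤ _ := Real.rpow_le_rpow_of_exponent_le hR (neg_le_neg (min_le_left _ _))
  calc M * θ ^ k * (1 - θ)⁻¹ = M * (1 - θ)⁻¹ * θ⁻¹ * θ ^ (k + 1) := by field_simp; ring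
    _ ≤ _ := by gcongr

/-- For `1 < p < ∞` and `ω ∈ A_p`, there exist `q ∈ (0,p)` and `C > 0`
such that for every `R ≥ 1`, `∫_{|x|>R} ω(x)|x|^{−np} dx ≤ C R^{−n(p−q)}`; in particular,
this integral is finite and tends to `0` as `R → ∞`. -/
theorem statement10 {n : ℕ} (p : ℝ) (hp : 1 < p)
    (ω : Rn n → ℝ) (hω : IsAp n p ω) :
    ∃ q C : ℝ, 0 < q ∧ q < p ∧ 0 < C ∧
      (∀ R : ℝ, 1 ≤ R →
        (∫⁻ x in {x : Rn n | R < ‖x‖},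
            ENNReal.ofReal (ω x * ‖x‖ ^ (-((n : ℝ) * p)))) ≤
          ENNReal.ofReal (C * R ^ (-((n : ℝ) * (p - q))))) ∧
      (∀ R : ℝ, 1 ≤ R →
        (∫⁻ x in {x : Rn n | R < ‖x‖},
            ENNReal.ofReal (ω x * ‖x‖ ^ (-((n : ℝ) * p)))) ≠ ⊤) ∧
      Tendsto (fun R : ℝ =>
          ∫⁻ x in {x : Rn n | R < ‖x‖},
            ENNReal.ofReal (ω x * ‖x‖ ^ (-((n : ℝ) * p))))
        atTop (𝓝 0) := by
  classical
  rcases Nat.eq_zero_or_pos n with rfl | hn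
  · have hz : ∀ R : ℝ, 1 ≤ R → (∫⁻ x in {x : Rn 0 | R < ‖x‖},
        ENNReal.ofReal (ω x * ‖x‖ ^ (-(((0 : ℕ) : ℝ) * p)))) = 0 := by
      intro R hR
      have : {x : Rn 0 | R < ‖x‖} = ∅ := by
        ext x
        have : x = 0 := Subsingleton.elim _ _
        simp [this]; linarith
      rw [this]; simp
    refine ⟨p / 2, 1, by linarith, by linarith, one_pos, fun R hR => ?_, fun R hR => ?_, ?_⟩
    · rw [hz R hR]; exact zero_le
    · rw [hz R hR]; simp
    · refine tendsto_const_nhds.congr' ?_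
      filter_upwards [eventually_ge_atTop 1] with R hR
      exact (hz R hR).symm
  · obtain ⟨C, t, hC, ht0, ht1, hb⟩ := aux_decay hn p hp ω hω
    have hn' : (0 : ℝ) < n := by exact_mod_cast hn
    have htn : (n : ℝ) * (p - (p - t / n)) = t := by field_simp; ring
    have htp : t / n ≤ p / 2 := by
      rw [div_le_iff₀ hn']; linarith
    have htp' : 0 < t / n := by positivity
    refine ⟨p - t / n, C, by linarith, by linarith, hC, ?_, fun R hR => ?_, ?_⟩
    · rw [htn]; exact hb
    · exact ne_top_of_le_ne_top ENNReal.ofReal_ne_top (hb R hR)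
    · have h0 : Tendsto (fun R : ℝ => ENNReal.ofReal (C * R ^ (-t))) atTop (𝓝 0) := by
        have := ENNReal.tendsto_ofReal ((tendsto_rpow_neg_atTop ht0).const_mul C)
        simpa using this
      refine tendsto_of_tendsto_of_tendsto_of_le_of_le' tendsto_const_nhds h0
        (Eventually.of_forall fun _ => zero_le) ?_
      filter_upwards [eventually_ge_atTop 1] with R hR using hb R hR
end
end
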